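/- Let X be a finite set, Y ⊆ X a nonempty subset with X ∖ Y = {x₁, …, x_l} enumerated, and let φ_X^k : RP(X)^k → RP(X) be a k-consensus function that is Pareto on rooted triples. Then for all T₁, …, T_k ∈ RP(Y), the consensus of the extended trees is the extension of its restriction: φ_X^k(T₁^X, …, T_k^X) = (φ_X^k(T₁^X, …, T_k^X)|_Y)^X. -/

import Mathlib

open Set

variable {α : Type*}

/-- `T` is the hierarchy of clusters of a rooted phylogenetic tree on the taxon set `X`:
a family of nonempty subsets of `X` containing `X` itself and all singletons, in which
any two members intersect trivially (`A ∩ B ∈ {∅, A, B}`). -/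
def IsHierarchy (X : Set α) (T : Set (Set α)) : Prop :=
  (∀ C ∈ T, C ⊆ X ∧ C.Nonempty) ∧ X ∈ T ∧ (∀ x ∈ X, ({x} : Set α) ∈ T) ∧
    ∀ A ∈ T, ∀ B ∈ T, A ∩ B = ∅ ∨ A ∩ B = A ∨ A ∩ B = B

/-- `RP X`: rooted phylogenetic trees on `X`, modeled as their hierarchies of clusters. -/
def RP (X : Set α) : Set (Set (Set α)) := {T | IsHierarchy X T}

/-- Restriction `T|_Y` of a tree to a subset `Y` of the taxa:
`T|_Y = {C ∩ Y : C ∈ T, C ∩ Y ≠ ∅}`. -/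
def restrictTree (Y : Set α) (T : Set (Set α)) : Set (Set α) :=
  {D | ∃ C ∈ T, D = C ∩ Y ∧ (C ∩ Y).Nonempty}

/-- A tree is binary iff it is maximal in `(RP X, ⊆)`. -/
def IsBinary (X : Set α) (T : Set (Set α)) : Prop :=
  T ∈ RP X ∧ ∀ T' ∈ RP X, T ⊆ T' → T' = T

/-- `RBP X`: rooted binary phylogenetic trees on `X`. -/
def RBP (X : Set α) : Set (Set (Set α)) := {T | IsBinary X T}

/-- Relabeling a tree along a map `σ`: `σ·T = {σ(C) : C ∈ T}`. -/
def mapTree (σ : α → α) (T : Set (Set α)) : Set (Set α) := (Set.image σ) '' T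

/-- Given nonempty `Y ⊆ X` and an enumeration `xs = [x₁, …, x_l]` of `X ∖ Y`, the tree
`T^X` on `X` obtained from `T ∈ RP(Y)` by attaching `x₁, …, x_l` in a caterpillar above
the root of `T`:
`T^X = T ∪ {{x₁}, …, {x_l}} ∪ {Y ∪ {x_{j+1}, …, x_l} : 0 ≤ j ≤ l}`. -/
def extendTree (Y : Set α) (xs : List α) (T : Set (Set α)) : Set (Set α) :=
  T ∪ {C | ∃ x ∈ xs, C = ({x} : Set α)} ∪
    {C | ∃ j ≤ xs.length, C = Y ∪ {a | a ∈ xs.drop j}}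

theorem aux_cluster (X : Set α) (hXfin : X.Finite) (T : Set (Set α)) (hT : T ∈ RP X)
    (S : Set α) (hS : S.Nonempty) (hSX : S ⊆ X)
    (h : ∀ a ∈ S, ∀ b ∈ S, a ≠ b → ∀ c ∈ X, c ∉ S → ∃ C ∈ T, a ∈ C ∧ b ∈ C ∧ c ∉ C) :
    S ∈ T := by
  obtain ⟨h1, h2, h3, h4⟩ := hT
  have hTfin : T.Finite := hXfin.finite_subsets.subset (fun C hC => (h1 C hC).1)
  obtain ⟨a, ha⟩ := hS
  obtain ⟨D, hD⟩ := (hTfin.subset (sep_subset T (fun C => S ⊆ C))).exists_minimal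
    ⟨X, h2, hSX⟩
  by_cases hDS : D ⊆ S
  · rw [Subset.antisymm hD.prop.2 hDS]; exact hD.prop.1
  exfalso
  obtain ⟨d, hdD, hdS⟩ := not_subset.1 hDS
  have hdX := (h1 D hD.prop.1).1 hdD
  obtain ⟨E, hE⟩ := (hTfin.subset (sep_subset T (fun C => a ∈ C ∧ d ∉ C))).exists_maximal
    ⟨{a}, h3 a (hSX ha), rfl, fun hh => hdS (by rw [mem_singleton_iff.1 hh]; exact ha)⟩
  obtain ⟨hET, haE, hdE⟩ := hE.prop
  have hSE : S ⊆ E := by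
    intro b hb
    by_cases hab : a = b
    · rw [← hab]; exact haE
    obtain ⟨C, hC, haC, hbC, hdC⟩ := h a ha b hb hab d hdX hdS
    rcases h4 C hC E hET with h5 | h5 | h5
    · exact absurd (show a ∈ C ∩ E from ⟨haC, haE⟩) (by rw [h5]; simp)
    · exact (inter_eq_left.1 h5) hbC
    · exact hE.le_of_ge ⟨hC, haC, hdC⟩ (inter_eq_right.1 h5) hbC
  rcases h4 D hD.prop.1 E hET with h5 | h5 | h5
  · exact absurd (show a ∈ D ∩ E from ⟨hD.prop.2 ha, haE⟩) (by rw [h5]; simp)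
  · exact hdE ((inter_eq_left.1 h5) hdD)
  · exact hdE (hD.le_of_le ⟨hET, hSE⟩ (inter_eq_right.1 h5) hdD)

theorem aux_single (x : α) (A : Set α) : ({x} : Set α) ∩ A = ∅ ∨ ({x} : Set α) ∩ A = {x} := by
  by_cases h : x ∈ A
  · right; simpa using h
  · left; simpa using h

theorem aux_drop (xs : List α) {i j : ℕ} (h : i ≤ j) (Y : Set α) :
    Y ∪ {a | a ∈ xs.drop j} ⊆ Y ∪ {a | a ∈ xs.drop i} :=
  union_subset_union_right _ (fun _ ha => (List.drop_subset_drop_left xs h) ha)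

theorem aux_extend (X Y : Set α) (hY : Y.Nonempty) (hYX : Y ⊆ X)
    (xs : List α) (hxs : {a | a ∈ xs} = X \ Y) (T : Set (Set α)) (hT : T ∈ RP Y) :
    extendTree Y xs T ∈ RP X := by
  obtain ⟨h1, h2, h3, h4⟩ := hT
  have hm : ∀ a, a ∈ xs ↔ a ∈ X ∧ a ∉ Y := fun a => by
    have := Set.ext_iff.1 hxs a; simpa using this
  refine ⟨?_, ?_, ?_, ?_⟩
  · rintro C ((hC | ⟨x, hx, rfl⟩) | ⟨j, hj, rfl⟩)
    · exact ⟨(h1 C hC).1.trans hYX, (h1 C hC).2⟩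
    · exact ⟨by simpa using ((hm x).1 hx).1, singleton_nonempty x⟩
    · exact ⟨union_subset hYX (fun a ha => ((hm a).1 (List.mem_of_mem_drop ha)).1),
        hY.mono subset_union_left⟩
  · right
    refine ⟨0, Nat.zero_le _, ?_⟩
    rw [List.drop_zero, hxs, union_diff_cancel hYX]
  · intro x hx
    left
    by_cases hxY : x ∈ Y
    · exact Or.inl (h3 x hxY)
    · exact Or.inr ⟨x, (hm x).2 ⟨hx, hxY⟩, rfl⟩
  · rintro A ((hA | ⟨x, hx, rfl⟩) | ⟨i, hi, rfl⟩) B hB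
    · rcases hB with ((hB | ⟨y, hy, rfl⟩) | ⟨j, hj, rfl⟩)
      · exact h4 A hA B hB
      · rw [inter_comm]; have := aux_single y A; tauto
      · right; left
        exact inter_eq_left.2 ((h1 A hA).1.trans subset_union_left)
    · have := aux_single x B; tauto
    · rcases hB with ((hB | ⟨y, hy, rfl⟩) | ⟨j, hj, rfl⟩)
      · right; right
        exact inter_eq_right.2 ((h1 B hB).1.trans subset_union_left)
      · rw [inter_comm]; have := aux_single y (Y ∪ {a | a ∈ xs.drop i}); tauto
      · right
        rcases le_total i j with h | h
        · right; exact inter_eq_right.2 (aux_drop xs h Y)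
        · left; exact inter_eq_left.2 (aux_drop xs h Y)

theorem aux_triple (a b c : α) (hac : a ≠ c) (hbc : b ≠ c) :
    ({{a, b, c}, {a, b}, {a}, {b}, {c}} : Set (Set α)) ∈ RP ({a, b, c} : Set α) := by
  refine ⟨?_, ?_, ?_, ?_⟩
  · rintro C (rfl | rfl | rfl | rfl | rfl) <;> refine ⟨?_, by simp⟩ <;> intro x hx <;>
      simp at hx ⊢ <;> tauto
  · simp
  · rintro x (rfl | rfl | rfl) <;> simp
  · have hs : ∀ (x : α) (A : Set α), ({x} : Set α) ∩ A = ∅ ∨ ({x} : Set α) ∩ A = {x} ∨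
        ({x} : Set α) ∩ A = A := fun x A => by have := aux_single x A; tauto
    have hs' : ∀ (x : α) (A : Set α), A ∩ {x} = ∅ ∨ A ∩ {x} = A ∨
        A ∩ {x} = {x} := fun x A => by rw [inter_comm]; have := aux_single x A; tauto
    have hl : ({a, b} : Set α) ⊆ {a, b, c} := by intro x hx; simp at hx ⊢; tauto
    rintro A (rfl | rfl | rfl | rfl | rfl) B (rfl | rfl | rfl | rfl | rfl) <;>
      first
      | exact hs _ _
      | exact hs' _ _
      | exact Or.inr (Or.inl (inter_self _))
      | exact Or.inr (Or.inl (inter_eq_left.2 hl))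
      | exact Or.inr (Or.inr (inter_eq_right.2 hl))

theorem aux_restrict (X : Set α) (T : Set (Set α)) (hT : T ∈ RP X) (a b c : α)
    (ha : a ∈ X) (hb : b ∈ X) (hc : c ∈ X)
    (S : Set α) (hS : S ∈ T) (haS : a ∈ S) (hbS : b ∈ S) (hcS : c ∉ S) :
    ({{a, b, c}, {a, b}, {a}, {b}, {c}} : Set (Set α)) ⊆ restrictTree {a, b, c} T := by
  obtain ⟨h1, h2, h3, h4⟩ := hT
  have key : ∀ D C : Set α, C ∈ T → D.Nonempty → D = C ∩ {a, b, c} →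
      D ∈ restrictTree {a, b, c} T := fun D C hC hD h => ⟨C, hC, h, h ▸ hD⟩
  rintro D (rfl | rfl | rfl | rfl | rfl)
  · refine key _ X h2 (by simp) (inter_eq_right.2 ?_).symm
    rintro x (rfl | rfl | rfl) <;> assumption
  · refine key _ S hS (by simp) ?_
    ext x
    constructor
    · rintro (rfl | rfl)
      · exact ⟨haS, by simp⟩
      · exact ⟨hbS, by simp⟩
    · rintro ⟨hx, (rfl | rfl | rfl)⟩
      · simp
      · simp
      · exact absurd hx hcS
  · exact key _ _ (h3 _ ha) (by simp) (inter_eq_left.2 (by simp)).symm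
  · exact key _ _ (h3 _ hb) (by simp) (inter_eq_left.2 (by simp)).symm
  · exact key _ _ (h3 _ hc) (by simp) (inter_eq_left.2 (by simp)).symm

/-- Let `Y` be a nonempty subset of a finite set `X`, with `X ∖ Y`
enumerated by the duplicate-free list `xs`, and let `φ : RP(X)^k → RP(X)` be a
`k`-consensus function that is Pareto on rooted triples. Then for all
`T₁, …, T_k ∈ RP(Y)` we have `φ (T₁^X, …, T_k^X) = (φ (T₁^X, …, T_k^X)|_Y)^X`. -/
theorem pareto_consensus_of_extended_profile_is_extension
    (X Y : Set α) (hXfin : X.Finite) (hY : Y.Nonempty) (hYX : Y ⊆ X)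
    (xs : List α) (hnodup : xs.Nodup) (hxs : {a | a ∈ xs} = X \ Y)
    (k : ℕ) (hk : 1 ≤ k)
    (φ : (Fin k → Set (Set α)) → Set (Set α))
    -- `φ` maps profiles of trees on `X` to trees on `X`
    (hmaps : ∀ Ts : Fin k → Set (Set α), (∀ i, Ts i ∈ RP X) → φ Ts ∈ RP X)
    -- Pareto on rooted triples
    (hPareto : ∀ W : Set α, W ⊆ X → W.ncard = 3 → ∀ T' ∈ RP W,
      ∀ Ts : Fin k → Set (Set α), (∀ i, Ts i ∈ RP X) →
        (∀ i, T' ⊆ restrictTree W (Ts i)) → T' ⊆ restrictTree W (φ Ts))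
    (Ts : Fin k → Set (Set α)) (hTs : ∀ i, Ts i ∈ RP Y) :
    φ (fun i => extendTree Y xs (Ts i)) =
      extendTree Y xs (restrictTree Y (φ (fun i => extendTree Y xs (Ts i)))) := by
  have hE : ∀ i, extendTree Y xs (Ts i) ∈ RP X :=
    fun i => aux_extend X Y hY hYX xs hxs (Ts i) (hTs i)
  have hP := hmaps _ hE
  have hPP := fun W hW hW3 T' hT' => hPareto W hW hW3 T' hT' _ hE
  generalize φ (fun i => extendTree Y xs (Ts i)) = P at hP hPP ⊢
  have hm : ∀ a, a ∈ xs ↔ a ∈ X ∧ a ∉ Y := fun a => by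
    have := Set.ext_iff.1 hxs a; simpa using this
  have hSP : ∀ j ≤ xs.length, Y ∪ {a | a ∈ xs.drop j} ∈ P := by
    intro j hj
    have hSX : Y ∪ {a | a ∈ xs.drop j} ⊆ X :=
      union_subset hYX (fun a ha => ((hm a).1 (List.mem_of_mem_drop ha)).1)
    refine aux_cluster X hXfin P hP _ (hY.mono subset_union_left) hSX ?_
    intro a ha b hb hab c hc hcS
    have hac : a ≠ c := fun h => hcS (h ▸ ha)
    have hbc : b ≠ c := fun h => hcS (h ▸ hb)
    have hsub := hPP {a, b, c} (by rintro x (rfl | rfl | rfl); exacts [hSX ha, hSX hb, hc])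
      (Set.ncard_eq_three.2 ⟨a, b, c, hab, hac, hbc, rfl⟩) _ (aux_triple a b c hac hbc)
      (fun i => aux_restrict X _ (hE i) a b c (hSX ha) (hSX hb) hc
        (Y ∪ {a | a ∈ xs.drop j}) (Or.inr ⟨j, hj, rfl⟩) ha hb hcS)
    obtain ⟨C, hC, hCe, -⟩ := hsub (show ({a, b} : Set α) ∈ _ by simp)
    refine ⟨C, hC, ?_, ?_, ?_⟩
    · exact (show a ∈ C ∩ {a, b, c} by rw [← hCe]; simp).1
    · exact (show b ∈ C ∩ {a, b, c} by rw [← hCe]; simp).1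
    · intro hcC
      have : c ∈ ({a, b} : Set α) := by rw [hCe]; exact ⟨hcC, by simp⟩
      rcases this with h | h
      · exact hac h.symm
      · exact hbc h.symm
  obtain ⟨h1, h2, h3, h4⟩ := hP
  have hYP : Y ∈ P := by simpa using hSP xs.length le_rfl
  apply Subset.antisymm
  · intro C hC
    by_cases hCY : C ⊆ Y
    · left; left
      have : C ∩ Y = C := inter_eq_left.2 hCY
      exact ⟨C, hC, this.symm, by rw [this]; exact (h1 C hC).2⟩
    have hind : ∀ j ≤ xs.length, C ⊆ Y ∪ {a | a ∈ xs.drop j} ∨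
        C ∈ extendTree Y xs (restrictTree Y P) := by
      intro j
      induction j with
      | zero =>
        intro _; left
        rw [List.drop_zero, hxs, union_diff_cancel hYX]; exact (h1 C hC).1
      | succ j ih =>
        intro hj
        rcases ih (by omega) with h | h
        swap
        · exact Or.inr h
        have hd : xs.drop j = xs[j] :: xs.drop (j+1) := List.drop_eq_getElem_cons hj
        rcases h4 C hC _ (hSP (j+1) hj) with h5 | h5 | h5
        · right; left; right
          refine ⟨xs[j], List.getElem_mem _, ?_⟩
          refine ((h1 C hC).2.subset_singleton_iff).1 ?_
          intro x hx
          by_contra hne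
          have : x ∈ C ∩ (Y ∪ {a | a ∈ xs.drop (j+1)}) := by
            refine ⟨hx, ?_⟩
            rcases h hx with h6 | h6
            · exact Or.inl h6
            · right
              rw [mem_setOf_eq, hd, List.mem_cons] at h6
              exact h6.resolve_left hne
          rw [h5] at this; exact this
        · exact Or.inl (inter_eq_left.1 h5)
        · by_cases hx : xs[j] ∈ C
          · right; right
            refine ⟨j, by omega, Subset.antisymm h ?_⟩
            rintro x (hxY | hxd)
            · exact inter_eq_right.1 h5 (Or.inl hxY)
            · rw [mem_setOf_eq, hd, List.mem_cons] at hxd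
              rcases hxd with rfl | hxd
              · exact hx
              · exact inter_eq_right.1 h5 (Or.inr hxd)
          · left
            intro x hxC
            rcases h hxC with h6 | h6
            · exact Or.inl h6
            · right
              rw [mem_setOf_eq, hd, List.mem_cons] at h6
              exact h6.resolve_left (fun e => hx (e ▸ hxC))
    rcases hind xs.length le_rfl with h | h
    · exact absurd (by simpa using h) hCY
    · exact h
  · rintro C ((⟨D, hD, rfl, hne⟩ | ⟨x, hx, rfl⟩) | ⟨j, hj, rfl⟩)
    · rcases h4 D hD Y hYP with h | h | h
      · rw [h] at hne; exact absurd hne (by simp)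
      · rw [h]; exact hD
      · rw [h]; exact hYP
    · exact h3 x ((hm x).1 hx).1
    · exact hSP j hj
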